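/- Let Y_{ab} be a Yano tensor of rank two on U, let X^m be a smooth vector field with ∇_cY_{ab} = ε_{abcm}X^m, suppose X is a Killing vector field of g, and suppose (£_XY)_{ab} = 0. Let K_{ab} := Y_{am}g^{mn}Y_{nb} and define H^a := g^{am}K_{mc}X^c (equivalently H^a = Y^a_{ b}Y^b_{ c}X^c). Then H is also a Killing vector field of g: ∇_aH_b + ∇_bH_a = 0 on U, where H_a := g_{am}H^m. -/

import Mathlib

/-!
STATEMENT 12: If `Y` is a Yano tensor with `∇_cY_{ab} = ε_{abcm}X^m`, `X` is a
Killing vector field of `g` and `£_XY = 0`, then with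
`K_{ab} := Y_{am}g^{mn}Y_{nb}` and `H^a := g^{am}K_{mc}X^c`, the vector field
`H` is also a Killing vector field of `g`: `∇_aH_b + ∇_bH_a = 0`.
-/

noncomputable section

abbrev Pt : Type := Fin 4 → ℝ

/-- Partial derivative of a scalar field in the `c`-th coordinate direction. -/
def pd (f : Pt → ℝ) (c : Fin 4) (p : Pt) : ℝ := fderiv ℝ f p (Pi.single c 1)

/-- Covariant derivative `∇_c X_a` of a covector field. -/
def covVec (Γ : Fin 4 → Fin 4 → Fin 4 → Pt → ℝ) (X : Fin 4 → Pt → ℝ)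
    (c a : Fin 4) (p : Pt) : ℝ :=
  pd (X a) c p - ∑ m, Γ m c a p * X m p

/-- Covariant derivative `∇_c Y_{ab}` of a (0,2)-tensor field. -/
def cov2 (Γ : Fin 4 → Fin 4 → Fin 4 → Pt → ℝ) (Y : Fin 4 → Fin 4 → Pt → ℝ)
    (c a b : Fin 4) (p : Pt) : ℝ :=
  pd (Y a b) c p - ∑ m, Γ m c a p * Y m b p - ∑ m, Γ m c b p * Y a m p

/-- Sign of `(a,b,c,d)` as a permutation of `(0,1,2,3)`; `0` if indices repeat. -/
def sgn4 (a b c d : Fin 4) : ℝ :=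
  let v : Fin 4 → ℝ := ![(a.1 : ℝ), (b.1 : ℝ), (c.1 : ℝ), (d.1 : ℝ)]
  ∏ i : Fin 4, ∏ j : Fin 4, if i < j then (v j - v i) / ((j.1 : ℝ) - (i.1 : ℝ)) else 1

/-- The volume tensor `ε_{abcd} = √(−det g)·sgn(abcd)`. -/
def eps (g : Fin 4 → Fin 4 → Pt → ℝ) (a b c d : Fin 4) (p : Pt) : ℝ :=
  Real.sqrt (-(Matrix.det (Matrix.of fun i j => g i j p))) * sgn4 a b c d

/-- Lie derivative of a (0,2)-tensor field along the vector field `X`. -/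
def lie2 (X : Fin 4 → Pt → ℝ) (T : Fin 4 → Fin 4 → Pt → ℝ)
    (a b : Fin 4) (p : Pt) : ℝ :=
  (∑ c, X c p * pd (T a b) c p) + (∑ c, T c b p * pd (X c) a p)
    + (∑ c, T a c p * pd (X c) b p)

/-- The square `K_{ab} = Y_{am} g^{mn} Y_{nb}` of a (0,2)-tensor `Y`. -/
def Ksq (ginv Y : Fin 4 → Fin 4 → Pt → ℝ) (a b : Fin 4) (p : Pt) : ℝ :=
  ∑ m, ∑ n, Y a m p * ginv m n p * Y n b p

/-- The vector field `H^a := g^{am} K_{mc} X^c`. -/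
def Hvec (ginv K : Fin 4 → Fin 4 → Pt → ℝ) (X : Fin 4 → Pt → ℝ)
    (a : Fin 4) (p : Pt) : ℝ :=
  ∑ m, ∑ c, ginv a m p * K m c p * X c p

open scoped Matrix

/-- The components of a (0,2)-tensor field at a point, as a matrix. -/
def fieldMat (T : Fin 4 → Fin 4 → Pt → ℝ) (p : Pt) : Matrix (Fin 4) (Fin 4) ℝ :=
  Matrix.of fun i j => T i j p

/-- The connection matrix `(Γ_c)_{am} = Γ^m_{ca}` at a point. -/
def connMat (Γ : Fin 4 → Fin 4 → Fin 4 → Pt → ℝ) (c : Fin 4) (p : Pt) :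
    Matrix (Fin 4) (Fin 4) ℝ :=
  Matrix.of fun a m => Γ m c a p

/-- The covariant derivative `∇_a X^c = ∂_a X^c + Γ^c_{am} X^m` of a vector field. -/
def gradMat (Γ : Fin 4 → Fin 4 → Fin 4 → Pt → ℝ) (X : Fin 4 → Pt → ℝ) (p : Pt) :
    Matrix (Fin 4) (Fin 4) ℝ :=
  Matrix.of fun a c => pd (X c) a p + ∑ m, Γ c a m p * X m p

theorem fieldMat_mul_eq_one {S T : Fin 4 → Fin 4 → Pt → ℝ} {p : Pt}
    (h : ∀ a b, (∑ m, S a m p * T m b p) = if a = b then 1 else 0) :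
    fieldMat S p * fieldMat T p = 1 := by
  ext i j
  simpa [fieldMat, Matrix.mul_apply, Matrix.one_apply] using h i j

theorem sgn4_swap_two_four (a b c d : Fin 4) : sgn4 a d c b = -sgn4 a b c d := by
  simp [sgn4, Fin.prod_univ_four]
  ring

theorem sgn4_swap_three_four (a b c d : Fin 4) : sgn4 a b d c = -sgn4 a b c d := by
  simp [sgn4, Fin.prod_univ_four]
  ring

theorem sum_sum_mul_eq_zero_of_antisymm {ι : Type*} [Fintype ι] (S : ι → ι → ℝ)
    (hS : ∀ i j, S j i = -S i j) (x : ι → ℝ) : ∑ i, (∑ j, S i j * x j) * x i = 0 := by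
  have h : ∑ i, (∑ j, S i j * x j) * x i = -∑ i, (∑ j, S i j * x j) * x i := by
    simp only [Finset.sum_mul]
    conv_lhs => rw [Finset.sum_comm]
    simp only [← Finset.sum_neg_distrib]
    refine Finset.sum_congr rfl fun i _ => Finset.sum_congr rfl fun j _ => ?_
    rw [hS i j]
    ring
  linarith

theorem pd_sum_mul {F G : Fin 4 → Pt → ℝ} {p : Pt} (hF : ∀ m, DifferentiableAt ℝ (F m) p)
    (hG : ∀ m, DifferentiableAt ℝ (G m) p) (c : Fin 4) :
    pd (fun q => ∑ m, F m q * G m q) c p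
      = ∑ m, pd (F m) c p * G m p + ∑ m, F m p * pd (G m) c p := by
  have h : HasFDerivAt (fun q => ∑ m, F m q * G m q)
      (∑ m, (F m p • fderiv ℝ (G m) p + G m p • fderiv ℝ (F m) p)) p :=
    HasFDerivAt.fun_sum fun m _ => (hF m).hasFDerivAt.mul (hG m).hasFDerivAt
  unfold pd
  rw [h.fderiv, ← Finset.sum_add_distrib]
  simp only [sum_apply, add_apply, smul_apply, smul_eq_mul]
  exact Finset.sum_congr rfl fun m _ => by ring

theorem pd_congr_of_eqOn {U : Set Pt} (hU : IsOpen U) {f h : Pt → ℝ} (hfh : Set.EqOn f h U)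
    {p : Pt} (hp : p ∈ U) (c : Fin 4) : pd f c p = pd h c p := by
  unfold pd
  rw [(hfh.eventuallyEq_of_mem (hU.mem_nhds hp)).fderiv_eq]

/-- Partial derivatives of a (0,2)-tensor field in terms of its covariant derivative. -/
theorem fieldMat_pd (Γ : Fin 4 → Fin 4 → Fin 4 → Pt → ℝ) (T : Fin 4 → Fin 4 → Pt → ℝ)
    (c : Fin 4) (p : Pt) :
    fieldMat (fun i j => pd (T i j) c) p
      = fieldMat (cov2 Γ T c) p + connMat Γ c p * fieldMat T p
        + fieldMat T p * (connMat Γ c p)ᵀ := by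
  ext i j
  simp only [fieldMat, connMat, Matrix.add_apply, Matrix.mul_apply, Matrix.transpose_apply,
    Matrix.of_apply, cov2, mul_comm (T i _ p)]
  ring

/-- For a torsion-free connection, partial derivatives in the Lie derivative may be replaced by
covariant ones. -/
theorem lie2_eq_cov (Γ : Fin 4 → Fin 4 → Fin 4 → Pt → ℝ) (X : Fin 4 → Pt → ℝ)
    (T : Fin 4 → Fin 4 → Pt → ℝ) {p : Pt} (hΓ : ∀ m a b, Γ m a b p = Γ m b a p) (a b : Fin 4) :
    lie2 X T a b p = ∑ c, X c p * cov2 Γ T c a b p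
      + (gradMat Γ X p * fieldMat T p + fieldMat T p * (gradMat Γ X p)ᵀ) a b := by
  have h₁ : ∑ c, X c p * ∑ m, Γ m c a p * T m b p = ∑ c, (∑ m, Γ c a m p * X m p) * T c b p := by
    simp only [Finset.mul_sum, Finset.sum_mul]
    rw [Finset.sum_comm]
    exact Finset.sum_congr rfl fun c _ => Finset.sum_congr rfl fun m _ => by rw [hΓ c m a]; ring
  have h₂ : ∑ c, X c p * ∑ m, Γ m c b p * T a m p = ∑ c, T a c p * ∑ m, Γ c b m p * X m p := by
    simp only [Finset.mul_sum]
    rw [Finset.sum_comm]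
    exact Finset.sum_congr rfl fun c _ => Finset.sum_congr rfl fun m _ => by rw [hΓ c m b]; ring
  simp only [lie2, cov2, gradMat, fieldMat, Matrix.add_apply, Matrix.mul_apply,
    Matrix.transpose_apply, Matrix.of_apply, mul_sub, mul_add, add_mul, Finset.sum_sub_distrib,
    Finset.sum_add_distrib, h₁, h₂, mul_comm (pd _ _ _) (T _ _ _)]
  ring

/-- Partial derivatives of the inverse of a parallel metric. -/
theorem fieldMat_pd_inv {U : Set Pt} (hU : IsOpen U) {Γ : Fin 4 → Fin 4 → Fin 4 → Pt → ℝ}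
    {g ginv : Fin 4 → Fin 4 → Pt → ℝ}
    (hg : ∀ a b, ∀ p ∈ U, DifferentiableAt ℝ (g a b) p)
    (hg' : ∀ a b, ∀ p ∈ U, DifferentiableAt ℝ (ginv a b) p)
    (hginv : ∀ p ∈ U, ∀ a b, (∑ m, g a m p * ginv m b p) = if a = b then 1 else 0)
    {p : Pt} (hp : p ∈ U) (hcompat : ∀ c a b, cov2 Γ g c a b p = 0) (c : Fin 4) :
    fieldMat (fun i j => pd (ginv i j) c) p
      = -(fieldMat ginv p * connMat Γ c p) - (connMat Γ c p)ᵀ * fieldMat ginv p := by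
  have hGI : fieldMat g p * fieldMat ginv p = 1 := fieldMat_mul_eq_one (hginv p hp)
  have hIG : fieldMat ginv p * fieldMat g p = 1 := mul_eq_one_comm.mp hGI
  have hprod : fieldMat (fun i j => pd (g i j) c) p * fieldMat ginv p
      + fieldMat g p * fieldMat (fun i j => pd (ginv i j) c) p = 0 := by
    ext i j
    have h := pd_sum_mul (fun m => hg i m p hp) (fun m => hg' m j p hp) c
    rw [pd_congr_of_eqOn hU (fun q hq => hginv q hq i j) hp] at h
    simpa [pd, fieldMat, Matrix.mul_apply] using h.symm
  have hcov : fieldMat (cov2 Γ g c) p = 0 := by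
    ext i j
    exact hcompat c i j
  rw [fieldMat_pd Γ g, hcov, zero_add] at hprod
  have h := congrArg (fieldMat ginv p * ·) hprod
  simp only [mul_add, add_mul, mul_zero] at h
  simp only [mul_assoc, hGI, mul_one] at h
  simp only [← mul_assoc, hIG, one_mul] at h
  rw [eq_neg_of_add_eq_zero_right h]
  abel

/-- If `A` is skew for `g` and preserves `Y`, it preserves `Y g⁻¹ Y`. -/
theorem mul_transpose_add_mul_eq_zero {n : Type*} [Fintype n] [DecidableEq n]
    {A G I Y : Matrix n n ℝ} (hGI : G * I = 1) (hG : A * G + G * Aᵀ = 0)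
    (hY : A * Y + Y * Aᵀ = 0) : A * (Y * I * Y) + Y * I * Y * Aᵀ = 0 := by
  have hIG : I * G = 1 := mul_eq_one_comm.mp hGI
  have hI : I * A + Aᵀ * I = 0 := by
    have h := congrArg (fun M => I * M * I) hG
    simp only [mul_add, add_mul, mul_zero, zero_mul] at h
    simpa only [mul_assoc, hGI, mul_one, ← mul_assoc I G, hIG, one_mul] using h
  calc A * (Y * I * Y) + Y * I * Y * Aᵀ
      = (A * Y + Y * Aᵀ) * I * Y + Y * I * (A * Y + Y * Aᵀ) - Y * (I * A + Aᵀ * I) * Y := by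
        noncomm_ring
    _ = 0 := by simp [hY, hI]

/-- The Leibniz rule for the lowered field `Y g⁻¹ Y X`. -/
theorem covVec_lowered {U : Set Pt} (hU : IsOpen U) {Γ : Fin 4 → Fin 4 → Fin 4 → Pt → ℝ}
    {g ginv Y : Fin 4 → Fin 4 → Pt → ℝ} {X : Fin 4 → Pt → ℝ}
    (hg : ∀ a b, ∀ p ∈ U, DifferentiableAt ℝ (g a b) p)
    (hg' : ∀ a b, ∀ p ∈ U, DifferentiableAt ℝ (ginv a b) p)
    (hY : ∀ a b, ∀ p ∈ U, DifferentiableAt ℝ (Y a b) p)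
    (hX : ∀ a, ∀ p ∈ U, DifferentiableAt ℝ (X a) p)
    (hginv : ∀ p ∈ U, ∀ a b, (∑ m, g a m p * ginv m b p) = if a = b then 1 else 0)
    {p : Pt} (hp : p ∈ U) (hcompat : ∀ c a b, cov2 Γ g c a b p = 0) (c b : Fin 4) :
    covVec Γ (fun i q => ∑ m, g i m q * Hvec ginv (Ksq ginv Y) X m q) c b p
      = (fieldMat (cov2 Γ Y c) p *ᵥ (fieldMat ginv p *ᵥ fieldMat Y p *ᵥ fun i => X i p)
        + fieldMat Y p *ᵥ fieldMat ginv p *ᵥ fieldMat (cov2 Γ Y c) p *ᵥ (fun i => X i p)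
        + fieldMat Y p *ᵥ fieldMat ginv p *ᵥ fieldMat Y p *ᵥ gradMat Γ X p c) b := by
  set V : Fin 4 → Pt → ℝ := fun n q => ∑ k, Y n k q * X k q
  set W : Fin 4 → Pt → ℝ := fun m q => ∑ n, ginv m n q * V n q
  have hVd : ∀ n, DifferentiableAt ℝ (V n) p := fun n =>
    DifferentiableAt.fun_sum fun k _ => (hY n k p hp).mul (hX k p hp)
  have hWd : ∀ m, DifferentiableAt ℝ (W m) p := fun m =>
    DifferentiableAt.fun_sum fun n _ => (hg' m n p hp).mul (hVd n)
  have hVp : (fun n => V n p) = fieldMat Y p *ᵥ fun i => X i p := rfl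
  have hWp : (fun m => W m p) = fieldMat ginv p *ᵥ fieldMat Y p *ᵥ fun i => X i p := rfl
  have hH : ∀ i, Set.EqOn (fun q => ∑ m, g i m q * Hvec ginv (Ksq ginv Y) X m q)
      (fun q => ∑ m, Y i m q * W m q) U := by
    intro i q hq
    have hGI : fieldMat g q * fieldMat ginv q = 1 := fieldMat_mul_eq_one (hginv q hq)
    have hK : fieldMat (Ksq ginv Y) q = fieldMat Y q * fieldMat ginv q * fieldMat Y q := by
      ext i j
      simp only [fieldMat, Ksq, Matrix.mul_apply, Matrix.of_apply, Finset.sum_mul]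
      exact Finset.sum_comm
    have hHq : (fun m => Hvec ginv (Ksq ginv Y) X m q)
        = fieldMat ginv q *ᵥ fieldMat (Ksq ginv Y) q *ᵥ fun k => X k q := by
      ext m
      simp [Hvec, Matrix.mulVec, dotProduct, fieldMat, Finset.mul_sum, mul_assoc]
    change (fieldMat g q *ᵥ fun m => Hvec ginv (Ksq ginv Y) X m q) i
      = (fieldMat Y q *ᵥ fieldMat ginv q *ᵥ fieldMat Y q *ᵥ fun k => X k q) i
    rw [hHq, hK]
    simp only [Matrix.mulVec_mulVec, ← mul_assoc, hGI, one_mul]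
  have hdV : (fun n => pd (V n) c p) = fieldMat (fun i j => pd (Y i j) c) p *ᵥ (fun i => X i p)
      + fieldMat Y p *ᵥ fun k => pd (X k) c p := by
    ext n
    exact pd_sum_mul (fun k => hY n k p hp) (fun k => hX k p hp) c
  have hdW : (fun m => pd (W m) c p)
      = fieldMat (fun i j => pd (ginv i j) c) p *ᵥ (fun n => V n p)
        + fieldMat ginv p *ᵥ fun n => pd (V n) c p := by
    ext m
    exact pd_sum_mul (fun n => hg' m n p hp) hVd c
  have hdH : pd (fun q => ∑ m, Y b m q * W m q) c p
      = (fieldMat (fun i j => pd (Y i j) c) p *ᵥ (fun m => W m p)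
        + fieldMat Y p *ᵥ fun m => pd (W m) c p) b :=
    pd_sum_mul (fun m => hY b m p hp) hWd c
  have hgrad : (fun k => pd (X k) c p)
      = gradMat Γ X p c - (connMat Γ c p)ᵀ *ᵥ fun i => X i p := by
    ext k
    simp [gradMat, connMat, Matrix.mulVec, dotProduct]
  have hΓ : ∑ m, Γ m c b p * ∑ k, g m k p * Hvec ginv (Ksq ginv Y) X k p
      = (connMat Γ c p *ᵥ fieldMat Y p *ᵥ fun m => W m p) b := by
    change _ = ∑ m, Γ m c b p * ∑ k, Y m k p * W k p
    exact Finset.sum_congr rfl fun m _ => congrArg (Γ m c b p * ·) (hH m hp)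
  rw [covVec, pd_congr_of_eqOn hU (hH b) hp, hdH, hΓ, ← Pi.sub_apply]
  refine congrFun ?_ b
  rw [hdW, hdV, hgrad, hWp, hVp, fieldMat_pd Γ Y,
    fieldMat_pd_inv hU hg hg' hginv hp hcompat]
  simp only [Matrix.add_mulVec, Matrix.sub_mulVec, Matrix.neg_mulVec, Matrix.mulVec_add,
    Matrix.mulVec_sub, Matrix.mulVec_neg, Matrix.mulVec_mulVec, add_mul, sub_mul, neg_mul,
    mul_assoc]
  abel

theorem induced_vector_field_is_killing
    (U : Set Pt) (hU : IsOpen U)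
    (Γ : Fin 4 → Fin 4 → Fin 4 → Pt → ℝ)
    (hΓsmooth : ∀ m a b, ContDiffOn ℝ (⊤ : ℕ∞) (Γ m a b) U)
    (hΓsymm : ∀ m a b, ∀ p ∈ U, Γ m a b p = Γ m b a p)
    (g ginv : Fin 4 → Fin 4 → Pt → ℝ)
    (hgsmooth : ∀ a b, ContDiffOn ℝ (⊤ : ℕ∞) (g a b) U)
    (hginvsmooth : ∀ a b, ContDiffOn ℝ (⊤ : ℕ∞) (ginv a b) U)
    (hgsymm : ∀ a b, ∀ p ∈ U, g a b p = g b a p)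
    (hgdet : ∀ p ∈ U, Matrix.det (Matrix.of fun i j => g i j p) < 0)
    (hginv : ∀ p ∈ U, ∀ a b, (∑ m, g a m p * ginv m b p) = if a = b then 1 else 0)
    (hcompat : ∀ p ∈ U, ∀ c a b, cov2 Γ g c a b p = 0)
    (Y : Fin 4 → Fin 4 → Pt → ℝ)
    (hYsmooth : ∀ a b, ContDiffOn ℝ (⊤ : ℕ∞) (Y a b) U)
    (hYanti : ∀ a b, ∀ p ∈ U, Y a b p = - Y b a p)
    (hYano : ∀ a b c, ∀ p ∈ U, cov2 Γ Y c b a p + cov2 Γ Y b c a p = 0)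
    (X : Fin 4 → Pt → ℝ)
    (hXsmooth : ∀ a, ContDiffOn ℝ (⊤ : ℕ∞) (X a) U)
    (hYX : ∀ p ∈ U, ∀ a b c, cov2 Γ Y c a b p = ∑ m, eps g a b c m p * X m p)
    (hKilling : ∀ p ∈ U, ∀ a b, lie2 X g a b p = 0)
    (hLieY : ∀ p ∈ U, ∀ a b, lie2 X Y a b p = 0) :
    ∀ p ∈ U, ∀ a b,
      covVec Γ (fun i q => ∑ m, g i m q * Hvec ginv (Ksq ginv Y) X m q) a b p
        + covVec Γ (fun i q => ∑ m, g i m q * Hvec ginv (Ksq ginv Y) X m q) b a p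
        = 0 := by
  intro p hp a b
  have hd : ∀ {f : Pt → ℝ}, ContDiffOn ℝ (⊤ : ℕ∞) f U → ∀ q ∈ U, DifferentiableAt ℝ f q :=
    fun hf q hq => (hf.contDiffAt (hU.mem_nhds hq)).differentiableAt (by simp)
  have hGI : fieldMat g p * fieldMat ginv p = 1 := fieldMat_mul_eq_one (hginv p hp)
  have hGt : (fieldMat g p)ᵀ = fieldMat g p := by
    ext i j
    exact hgsymm j i p hp
  have hYt : (fieldMat Y p)ᵀ = -fieldMat Y p := by
    ext i j
    exact hYanti j i p hp
  have hIt : (fieldMat ginv p)ᵀ = fieldMat ginv p := by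
    have h : (fieldMat ginv p)ᵀ * fieldMat g p = 1 := by
      rw [← hGt, ← Matrix.transpose_mul, hGI, Matrix.transpose_one]
    exact left_inv_eq_right_inv h hGI
  have hZX : ∀ c, fieldMat (cov2 Γ Y c) p *ᵥ (fun i => X i p) = 0 := by
    intro c
    ext i
    change ∑ k, cov2 Γ Y c i k p * X k p = 0
    simp only [hYX p hp]
    exact sum_sum_mul_eq_zero_of_antisymm (fun k m => eps g i k c m p)
      (fun k m => by simp only [eps, sgn4_swap_two_four i k c m]; ring) fun m => X m p
  have hXZ : ∀ i j, ∑ c, X c p * cov2 Γ Y c i j p = 0 := by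
    intro i j
    simp only [hYX p hp, mul_comm (X _ p) (∑ _, _)]
    exact sum_sum_mul_eq_zero_of_antisymm (fun c m => eps g i j c m p)
      (fun c m => by simp only [eps, sgn4_swap_three_four i j c m]; ring) fun m => X m p
  have hΓp : ∀ m a b, Γ m a b p = Γ m b a p := fun m a b => hΓsymm m a b p hp
  have hAG : gradMat Γ X p * fieldMat g p + fieldMat g p * (gradMat Γ X p)ᵀ = 0 := by
    ext i j
    have h := lie2_eq_cov Γ X g hΓp i j
    simpa [hKilling p hp, hcompat p hp] using h.symm
  have hAY : gradMat Γ X p * fieldMat Y p + fieldMat Y p * (gradMat Γ X p)ᵀ = 0 := by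
    ext i j
    have h := lie2_eq_cov Γ X Y hΓp i j
    rw [hLieY p hp, hXZ, zero_add] at h
    exact h.symm
  have hAK := mul_transpose_add_mul_eq_zero hGI hAG hAY
  set K := fieldMat Y p * fieldMat ginv p * fieldMat Y p with hK
  have hKt : Kᵀ = K := by
    simp [hK, Matrix.transpose_mul, hYt, hIt, mul_assoc]
  have hKA : ∀ i j, (K *ᵥ gradMat Γ X p i) j = (gradMat Γ X p * K) i j := by
    intro i j
    rw [← Matrix.transpose_apply (gradMat Γ X p * K), Matrix.transpose_mul, hKt]
    rfl
  have hsum : (K *ᵥ gradMat Γ X p a) b + (K *ᵥ gradMat Γ X p b) a = 0 := by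
    rw [hKA]
    exact congrFun (congrFun hAK a) b
  have hZ : ∀ w : Fin 4 → ℝ, (fieldMat (cov2 Γ Y a) p *ᵥ w) b
      + (fieldMat (cov2 Γ Y b) p *ᵥ w) a = 0 := by
    intro w
    change ∑ m, cov2 Γ Y a b m p * w m + ∑ m, cov2 Γ Y b a m p * w m = 0
    rw [← Finset.sum_add_distrib]
    exact Finset.sum_eq_zero fun m _ => by rw [← add_mul, hYano m b a p hp, zero_mul]
  have hcov := covVec_lowered hU (fun i j => hd (hgsmooth i j)) (fun i j => hd (hginvsmooth i j))
    (fun i j => hd (hYsmooth i j)) (fun i => hd (hXsmooth i)) hginv hp (hcompat p hp)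
  rw [hcov, hcov]
  simp only [hZX, Matrix.mulVec_zero, add_zero, Pi.add_apply]
  have hZ := hZ (fieldMat ginv p *ᵥ fieldMat Y p *ᵥ fun i => X i p)
  simp only [Matrix.mulVec_mulVec, ← mul_assoc] at hZ ⊢
  rw [← hK]
  linear_combination hZ + hsum
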